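/- Main Theorem, d-dimensional case: Let X ⊆ ℝ^d be a generic Delaunay set with parameters 0 < r < R, let D be a triangulation of X all of whose d-simplices are empty (the Delaunay triangulation of X), and let T be a uniformly bounded triangulation of X with parameter q. Let F be a real-valued functional on d-simplices such that e ≤ F(Δ) ≤ E for every d-simplex Δ whose edges have length at least 2r and whose circumradius is at most max(q,R), and suppose F belongs to class G: for every finite generic set Y ⊆ ℝ^d, every simplicial complex T' whose vertices all lie in Y and such that every point of Y contained in the underlying space of T' is a vertex of T', the sum of F over the d-simplices of Y that are empty with respect to Y and contained in the underlying space of T' is at most the sum of F over the d-simplices of T'. Then the densities satisfy f(D) ≤ f(T). -/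

import Mathlib

open Metric MeasureTheory Filter

noncomputable section

/-- A Delaunay set with parameters `r < R`: every open ball of radius `r` contains at most
one point of `X`, and every closed ball of radius `R` contains at least one point of `X`. -/
def DelaunaySet (d : ℕ) (X : Set (EuclideanSpace ℝ (Fin d))) (r R : ℝ) : Prop :=
  (∀ z : EuclideanSpace ℝ (Fin d), (X ∩ Metric.ball z r).Subsingleton) ∧
  (∀ z : EuclideanSpace ℝ (Fin d), (X ∩ Metric.closedBall z R).Nonempty)

/-- `T` is a triangulation of `X`: a simplicial complex with vertex set exactly `X`
whose underlying space is all of `ℝ^d`. -/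
def IsTriangulationOf (d : ℕ) (T : Geometry.SimplicialComplex ℝ (EuclideanSpace ℝ (Fin d)))
    (X : Set (EuclideanSpace ℝ (Fin d))) : Prop :=
  T.vertices = X ∧ T.space = Set.univ

/-- The finset `s` admits an enclosing sphere with radius at most `q` passing through all
its vertices; for a `d`-simplex in `ℝ^d` this says its circumradius is at most `q`. -/
def HasCircumradiusLE (d : ℕ) (s : Finset (EuclideanSpace ℝ (Fin d))) (q : ℝ) : Prop :=
  ∃ c : EuclideanSpace ℝ (Fin d), ∃ ρ : ℝ, ρ ≤ q ∧ ∀ v ∈ s, dist v c = ρ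

/-- `T` is uniformly bounded with parameter `q`: every `d`-simplex of `T` has
circumradius at most `q`. -/
def UniformlyBounded (d : ℕ) (T : Geometry.SimplicialComplex ℝ (EuclideanSpace ℝ (Fin d)))
    (q : ℝ) : Prop :=
  ∀ s ∈ T.faces, s.card = d + 1 → HasCircumradiusLE d s q

/-- The density of a functional `F` on a triangulation `T`: the lower limit, as `α → ∞`,
of the sum of `F` over the `d`-simplices of `T` contained in the closed ball of radius `α`
about the origin, divided by the volume of that ball. -/
def density (d : ℕ) (F : Finset (EuclideanSpace ℝ (Fin d)) → ℝ)
    (T : Geometry.SimplicialComplex ℝ (EuclideanSpace ℝ (Fin d))) : ℝ :=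
  Filter.liminf (fun α : ℝ =>
    (∑ᶠ s ∈ {s : Finset (EuclideanSpace ℝ (Fin d)) |
        s ∈ T.faces ∧ s.card = d + 1 ∧
          (s : Set (EuclideanSpace ℝ (Fin d))) ⊆ Metric.closedBall 0 α},
      F s) /
    (MeasureTheory.volume (Metric.closedBall (0 : EuclideanSpace ℝ (Fin d)) α)).toReal)
    Filter.atTop

/-- `X` is generic: no `d+2` points of `X` lie on a common `(d-1)`-sphere. -/
def Generic (d : ℕ) (X : Set (EuclideanSpace ℝ (Fin d))) : Prop :=
  ∀ Y : Finset (EuclideanSpace ℝ (Fin d)), ↑Y ⊆ X →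
    (∃ c ρ, ∀ y ∈ Y, dist y c = ρ) → Y.card ≤ d + 1

/-- The simplex with vertex set `s` is empty with respect to `X`: the open ball bounded by
a sphere through all vertices of `s` contains no point of `X`. -/
def EmptySimplex (d : ℕ) (s : Finset (EuclideanSpace ℝ (Fin d)))
    (X : Set (EuclideanSpace ℝ (Fin d))) : Prop :=
  ∃ c ρ, (∀ v ∈ s, dist v c = ρ) ∧ ∀ x ∈ X, ρ ≤ dist x c

/-- `D` is a Delaunay triangulation of `X`: a triangulation all of whose `d`-simplices
are empty. -/
def IsDelaunayTriangulation (d : ℕ)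
    (D : Geometry.SimplicialComplex ℝ (EuclideanSpace ℝ (Fin d)))
    (X : Set (EuclideanSpace ℝ (Fin d))) : Prop :=
  IsTriangulationOf d D X ∧ ∀ s ∈ D.faces, s.card = d + 1 → EmptySimplex d s X

/-- `F` belongs to class `G`: for every finite generic set `Y` and every simplicial complex
`T'` with vertices in `Y` such that every point of `Y` in the underlying space of `T'` is a
vertex of `T'`, the sum of `F` over the empty (Delaunay) `d`-simplices of `Y` contained in
the underlying space of `T'` is at most the sum of `F` over the `d`-simplices of `T'`. -/
def InClassG (d : ℕ) (F : Finset (EuclideanSpace ℝ (Fin d)) → ℝ) : Prop :=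
  ∀ Y : Finset (EuclideanSpace ℝ (Fin d)), Generic d ↑Y →
    ∀ T' : Geometry.SimplicialComplex ℝ (EuclideanSpace ℝ (Fin d)),
      T'.vertices ⊆ ↑Y →
      (∀ y ∈ Y, y ∈ T'.space → y ∈ T'.vertices) →
      (∑ᶠ s ∈ {s : Finset (EuclideanSpace ℝ (Fin d)) |
          ↑s ⊆ (Y : Set (EuclideanSpace ℝ (Fin d))) ∧ s.card = d + 1 ∧
          AffineIndependent ℝ ((↑) : ↑s → EuclideanSpace ℝ (Fin d)) ∧
          EmptySimplex d s ↑Y ∧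
          convexHull ℝ (s : Set (EuclideanSpace ℝ (Fin d))) ⊆ T'.space}, F s) ≤
      ∑ᶠ s ∈ {s : Finset (EuclideanSpace ℝ (Fin d)) |
          s ∈ T'.faces ∧ s.card = d + 1}, F s

section Packing

variable {d : ℕ} {X : Set (EuclideanSpace ℝ (Fin d))} {r : ℝ}

lemma DelaunaySet.two_mul_le_dist {R : ℝ} (hX : DelaunaySet d X r R) :
    X.Pairwise fun u v => 2 * r ≤ dist u v := by
  intro u hu v hv huv
  by_contra! h
  refine huv (hX.1 (midpoint ℝ u v) ⟨hu, ?_⟩ ⟨hv, ?_⟩)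
  · rw [mem_ball, dist_left_midpoint, Real.norm_two]
    linarith
  · rw [mem_ball, dist_right_midpoint, Real.norm_two]
    linarith

lemma card_mul_volume_le (hr : 0 < r) {A : Finset (EuclideanSpace ℝ (Fin d))}
    (hA : (A : Set (EuclideanSpace ℝ (Fin d))).Pairwise fun u v => 2 * r ≤ dist u v)
    {S : Set (EuclideanSpace ℝ (Fin d))} (hS : volume S ≠ ⊤)
    (hAS : ∀ v ∈ A, ball v r ⊆ S) :
    A.card * (r ^ d * volume.real (ball (0 : EuclideanSpace ℝ (Fin d)) 1)) ≤ volume.real S := by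
  have hdisj : (A : Set (EuclideanSpace ℝ (Fin d))).PairwiseDisjoint fun v => ball v r :=
    fun u hu v hv huv => ball_disjoint_ball (by linarith [hA hu hv huv])
  have hball : ∀ v : EuclideanSpace ℝ (Fin d), volume.real (ball v r) =
      r ^ d * volume.real (ball (0 : EuclideanSpace ℝ (Fin d)) 1) := fun v => by
    simp [measureReal_def, Measure.addHaar_ball_of_pos volume v hr, hr.le]
  calc (A.card : ℝ) * (r ^ d * volume.real (ball (0 : EuclideanSpace ℝ (Fin d)) 1))
      = ∑ v ∈ A, volume.real (ball v r) := by simp [hball]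
    _ = volume.real (⋃ v ∈ A, ball v r) :=
        (measureReal_biUnion_finset hdisj (fun v _ => measurableSet_ball)).symm
    _ ≤ volume.real S := measureReal_mono (Set.iUnion₂_subset hAS) hS

lemma volume_real_unitBall_pos :
    0 < volume.real (ball (0 : EuclideanSpace ℝ (Fin d)) 1) :=
  ENNReal.toReal_pos (measure_ball_pos _ _ one_pos).ne' measure_ball_lt_top.ne

lemma volume_real_closedBall (z : EuclideanSpace ℝ (Fin d)) {α : ℝ} (hα : 0 ≤ α) :
    volume.real (closedBall z α) =
      α ^ d * volume.real (ball (0 : EuclideanSpace ℝ (Fin d)) 1) := by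
  rw [Measure.addHaar_real_closedBall volume z hα, finrank_euclideanSpace_fin]

lemma card_mul_pow_le (hr : 0 < r) {A : Finset (EuclideanSpace ℝ (Fin d))}
    (hA : (A : Set (EuclideanSpace ℝ (Fin d))).Pairwise fun u v => 2 * r ≤ dist u v)
    {z : EuclideanSpace ℝ (Fin d)} {b : ℝ} (hb : 0 ≤ b)
    (hAb : (A : Set (EuclideanSpace ℝ (Fin d))) ⊆ closedBall z b) :
    A.card * r ^ d ≤ (b + r) ^ d := by
  have h := card_mul_volume_le hr hA (S := closedBall z (b + r)) measure_closedBall_lt_top.ne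
    fun v hv => ball_subset_closedBall.trans (closedBall_subset_closedBall' (by
      linarith [mem_closedBall.1 (hAb hv)]))
  rw [volume_real_closedBall z (by linarith), ← mul_assoc] at h
  exact le_of_mul_le_mul_right h volume_real_unitBall_pos

lemma card_mul_pow_le_of_annulus (hr : 0 < r) {A : Finset (EuclideanSpace ℝ (Fin d))}
    (hA : (A : Set (EuclideanSpace ℝ (Fin d))).Pairwise fun u v => 2 * r ≤ dist u v)
    {z : EuclideanSpace ℝ (Fin d)} {a b : ℝ} (ha : r ≤ a) (hab : a ≤ b)
    (hAb : ∀ v ∈ A, a < dist v z ∧ dist v z ≤ b) :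
    A.card * r ^ d ≤ (b + r) ^ d - (a - r) ^ d := by
  have hsub : closedBall z (a - r) ⊆ closedBall z (b + r) :=
    closedBall_subset_closedBall (by linarith)
  have h := card_mul_volume_le hr hA (S := closedBall z (b + r) \ closedBall z (a - r))
    (measure_ne_top_of_subset Set.sdiff_subset measure_closedBall_lt_top.ne) fun v hv x hx => by
      have h1 := hAb v hv
      have h2 := mem_ball.1 hx
      have h3 := dist_triangle x v z
      have h4 := dist_triangle v x z
      rw [dist_comm v x] at h4
      simp only [Set.mem_sdiff, mem_closedBall, not_le]
      constructor <;> linarith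
  rw [measureReal_sdiff hsub measurableSet_closedBall measure_closedBall_lt_top.ne, volume_real_closedBall z (by linarith),
    volume_real_closedBall z (by linarith), ← mul_assoc, ← sub_mul] at h
  exact le_of_mul_le_mul_right h volume_real_unitBall_pos

lemma finite_inter_closedBall (hr : 0 < r) (hX : X.Pairwise fun u v => 2 * r ≤ dist u v)
    (z : EuclideanSpace ℝ (Fin d)) (b : ℝ) : (X ∩ closedBall z b).Finite := by
  rcases lt_or_ge b 0 with hb | hb
  · simp [closedBall_eq_empty.2 hb]
  by_contra h
  obtain ⟨n, hn⟩ := exists_nat_gt ((b + r) ^ d / r ^ d)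
  obtain ⟨A, hA, rfl⟩ := Set.Infinite.exists_subset_card_eq h n
  rw [div_lt_iff₀ (by positivity)] at hn
  exact hn.not_ge (card_mul_pow_le hr (hX.mono (hA.trans Set.inter_subset_left)) hb
    (hA.trans Set.inter_subset_right))

/-- Simplices of bounded diameter on a separated set, each having a vertex in `V`, number at most
a constant times the size of `V`. -/
lemma finite_and_ncard_le (hr : 0 < r) (hX : X.Pairwise fun u v => 2 * r ≤ dist u v)
    {Q : ℝ} (hQ : 0 ≤ Q) {S : Set (Finset (EuclideanSpace ℝ (Fin d)))}
    (V : Finset (EuclideanSpace ℝ (Fin d)))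
    (hSX : ∀ s ∈ S, (s : Set (EuclideanSpace ℝ (Fin d))) ⊆ X)
    (hSQ : ∀ s ∈ S, ∀ u ∈ s, ∀ v ∈ s, dist u v ≤ Q)
    (hSV : ∀ s ∈ S, ∃ v ∈ s, v ∈ V) :
    S.Finite ∧ S.ncard ≤ V.card * 2 ^ ⌊(Q + r) ^ d / r ^ d⌋₊ := by
  classical
  let W : EuclideanSpace ℝ (Fin d) → Finset (EuclideanSpace ℝ (Fin d)) :=
    fun v => (finite_inter_closedBall hr hX v Q).toFinset
  have hsub : S ⊆ ↑(V.biUnion fun v => (W v).powerset) := fun s hs => by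
    obtain ⟨v, hvs, hvV⟩ := hSV s hs
    simp only [Finset.coe_biUnion, Set.mem_iUnion]
    refine ⟨v, hvV, Finset.mem_coe.2 (Finset.mem_powerset.2 fun u hu => ?_)⟩
    simp only [W, Set.Finite.mem_toFinset]
    exact ⟨hSX s hs hu, mem_closedBall.2 (hSQ s hs u hu v hvs)⟩
  refine ⟨(Finset.finite_toSet _).subset hsub, ?_⟩
  calc S.ncard ≤ (V.biUnion fun v => (W v).powerset).card := by
        rw [← Set.ncard_coe_finset]
        exact Set.ncard_le_ncard hsub (Finset.finite_toSet _)
    _ ≤ V.card * 2 ^ ⌊(Q + r) ^ d / r ^ d⌋₊ := by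
        refine Finset.card_biUnion_le_card_mul _ _ _ fun v _ => ?_
        rw [Finset.card_powerset]
        refine Nat.pow_le_pow_right two_pos (Nat.le_floor ?_)
        rw [le_div_iff₀ (by positivity)]
        refine card_mul_pow_le hr (hX.mono ?_) hQ (z := v) ?_ <;> intro x hx <;>
          simp only [W, Set.Finite.coe_toFinset] at hx
        exacts [hx.1, hx.2]

end Packing

section Spheres

variable {d : ℕ} {X : Set (EuclideanSpace ℝ (Fin d))}

/-- The difference of the powers of a point with respect to two spheres is affine. -/
lemma exists_affineMap_eq_power_sub_power (c c' : EuclideanSpace ℝ (Fin d)) (ρ ρ' : ℝ) :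
    ∃ g : EuclideanSpace ℝ (Fin d) →ᵃ[ℝ] ℝ, ∀ x,
      g x = (dist x c ^ 2 - ρ ^ 2) - (dist x c' ^ 2 - ρ' ^ 2) := by
  refine ⟨(((2 : ℝ) • innerSL ℝ (c' - c)).toLinearMap).toAffineMap +
    AffineMap.const ℝ _ (‖c‖ ^ 2 - ρ ^ 2 - ‖c'‖ ^ 2 + ρ' ^ 2), fun x => ?_⟩
  simp [dist_eq_norm, @norm_sub_sq ℝ, real_inner_comm]
  ring

/-- Two empty simplices of a generic set coincide as soon as one of them contains the centroid
of the other. -/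
lemma EmptySimplex.eq_of_centroid_mem (hgen : Generic d X)
    {s t : Finset (EuclideanSpace ℝ (Fin d))}
    (hsX : (s : Set (EuclideanSpace ℝ (Fin d))) ⊆ X)
    (htX : (t : Set (EuclideanSpace ℝ (Fin d))) ⊆ X)
    (hsc : s.card = d + 1) (htc : t.card = d + 1)
    (hs : EmptySimplex d s X) (ht : EmptySimplex d t X)
    (hst : s.centerMass (fun _ => (1 : ℝ)) id ∈
      convexHull ℝ (t : Set (EuclideanSpace ℝ (Fin d)))) : s = t := by
  classical
  obtain ⟨c, ρ, hsρ, hρ⟩ := hs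
  obtain ⟨c', ρ', htρ, hρ'⟩ := ht
  obtain ⟨g, hg⟩ := exists_affineMap_eq_power_sub_power c' c ρ' ρ
  have hs0 : s.Nonempty := Finset.card_pos.1 (by omega)
  have ht0 : t.Nonempty := Finset.card_pos.1 (by omega)
  have hρ0 : 0 ≤ ρ := by
    obtain ⟨v, hv⟩ := hs0
    exact hsρ v hv ▸ dist_nonneg
  have hρ0' : 0 ≤ ρ' := by
    obtain ⟨v, hv⟩ := ht0
    exact htρ v hv ▸ dist_nonneg
  have hgs : ∀ v ∈ s, 0 ≤ g v := fun v hv => by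
    rw [hg, hsρ v hv]
    nlinarith [hρ' v (hsX hv)]
  have hgt : ∀ v ∈ t, g v ≤ 0 := fun v hv => by
    rw [hg, htρ v hv]
    nlinarith [hρ v (htX hv)]
  have hconv : convexHull ℝ (t : Set (EuclideanSpace ℝ (Fin d))) ⊆ g ⁻¹' Set.Iic 0 :=
    convexHull_min (fun v hv => hgt v hv) ((convex_Iic 0).affine_preimage g)
  have hsum : (s.card : ℝ) * g (s.centerMass (fun _ => (1 : ℝ)) id) = ∑ v ∈ s, g v := by
    have hcard : (s.card : ℝ) ≠ 0 := by simp [hs0.ne_empty]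
    have hdec : ∀ x, g x = g.linear x + g 0 := fun x => congrFun g.decomp x
    rw [hdec, Finset.sum_congr rfl fun v _ => hdec v, Finset.sum_add_distrib, ← map_sum]
    simp [Finset.centerMass, mul_add, hcard]
  have hzero : ∑ v ∈ s, g v = 0 := by
    refine le_antisymm ?_ (Finset.sum_nonneg hgs)
    rw [← hsum]
    exact mul_nonpos_of_nonneg_of_nonpos (Nat.cast_nonneg _) (hconv hst)
  rw [Finset.sum_eq_zero_iff_of_nonneg hgs] at hzero
  have hcard := hgen (s ∪ t) (by simp [hsX, htX]) ⟨c', ρ', fun y hy => by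
    rcases Finset.mem_union.1 hy with hy | hy
    · have h := hzero y hy
      rw [hg, hsρ y hy] at h
      exact (sq_eq_sq₀ dist_nonneg hρ0').1 (by linarith)
    · exact htρ y hy⟩
  have h1 := Finset.eq_of_subset_of_card_le (Finset.subset_union_left (s₁ := s) (s₂ := t))
    (by omega)
  have h2 := Finset.eq_of_subset_of_card_le (Finset.subset_union_right (s₁ := s) (s₂ := t))
    (by omega)
  exact h1.trans h2.symm

lemma AffineIndependent.affineSpan_finset_eq_top {s : Finset (EuclideanSpace ℝ (Fin d))}
    (hs : AffineIndependent ℝ ((↑) : s → EuclideanSpace ℝ (Fin d))) (hsc : s.card = d + 1) :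
    affineSpan ℝ (s : Set (EuclideanSpace ℝ (Fin d))) = ⊤ := by
  have h := hs.affineSpan_eq_top_iff_card_eq_finrank_add_one.2 (by simp [hsc])
  simpa using h

lemma AffineIndependent.affineSpan_finset_ne_top {s : Finset (EuclideanSpace ℝ (Fin d))}
    (hs : AffineIndependent ℝ ((↑) : s → EuclideanSpace ℝ (Fin d))) (hsc : s.card ≠ d + 1) :
    affineSpan ℝ (s : Set (EuclideanSpace ℝ (Fin d))) ≠ ⊤ := by
  have h := hs.affineSpan_eq_top_iff_card_eq_finrank_add_one.not.2 (by simpa using hsc)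
  simpa using h

/-- Whether a nondegenerate simplex is empty is already decided by finitely many points. -/
lemma exists_finset_emptySimplex (s : Finset (EuclideanSpace ℝ (Fin d)))
    (hs : AffineIndependent ℝ ((↑) : s → EuclideanSpace ℝ (Fin d))) (hsc : s.card = d + 1) :
    ∃ Y : Finset (EuclideanSpace ℝ (Fin d)), (Y : Set (EuclideanSpace ℝ (Fin d))) ⊆ X ∧
      ∀ Z : Set (EuclideanSpace ℝ (Fin d)), ↑Y ⊆ Z → EmptySimplex d s Z → EmptySimplex d s X := by
  by_cases hsX : EmptySimplex d s X
  · exact ⟨∅, by simp, fun _ _ _ => hsX⟩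
  by_cases hsph : ∃ c ρ, ∀ v ∈ s, dist v c = ρ
  swap
  · exact ⟨∅, by simp, fun _ _ ⟨c, ρ, h, _⟩ => (hsph ⟨c, ρ, h⟩).elim⟩
  obtain ⟨c, ρ, hc⟩ := hsph
  obtain ⟨x, hxX, hx⟩ : ∃ x ∈ X, dist x c < ρ := by
    by_contra! h
    exact hsX ⟨c, ρ, hc, h⟩
  refine ⟨{x}, by simpa using hxX, fun Z hZ ⟨c', ρ', hc', hρ'⟩ => ?_⟩
  obtain ⟨g, hg⟩ := exists_affineMap_eq_power_sub_power c c' ρ ρ'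
  have hspan : affineSpan ℝ (s : Set (EuclideanSpace ℝ (Fin d))) ≤
      (AffineSubspace.mk' (0 : ℝ) ⊥).comap g := by
    rw [affineSpan_le]
    intro v hv
    simp [AffineSubspace.mem_mk', hg, hc v hv, hc' v hv]
  rw [hs.affineSpan_finset_eq_top hsc] at hspan
  have hgx : g x = 0 := by
    have := hspan (AffineSubspace.mem_top ℝ _ x)
    simpa [AffineSubspace.mem_mk'] using this
  have hρ0' : 0 ≤ ρ' := by
    obtain ⟨v, hv⟩ := Finset.card_pos.1 (by omega : 0 < s.card)
    exact hc' v hv ▸ dist_nonneg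
  rw [hg] at hgx
  have h1 := hρ' x (hZ (by simp))
  have h2 : 0 ≤ dist x c := dist_nonneg
  nlinarith

lemma EmptySimplex.mono {s : Finset (EuclideanSpace ℝ (Fin d))}
    {Y : Set (EuclideanSpace ℝ (Fin d))} (hs : EmptySimplex d s X) (hY : Y ⊆ X) :
    EmptySimplex d s Y := by
  obtain ⟨c, ρ, h, h'⟩ := hs
  exact ⟨c, ρ, h, fun x hx => h' x (hY hx)⟩

lemma EmptySimplex.hasCircumradiusLE {r R : ℝ} (hX : DelaunaySet d X r R)
    {s : Finset (EuclideanSpace ℝ (Fin d))} (hs : EmptySimplex d s X) :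
    HasCircumradiusLE d s R := by
  obtain ⟨c, ρ, h, h'⟩ := hs
  obtain ⟨x, hxX, hx⟩ := hX.2 c
  exact ⟨c, ρ, (h' x hxX).trans hx, h⟩

lemma HasCircumradiusLE.dist_le {s : Finset (EuclideanSpace ℝ (Fin d))} {Q : ℝ}
    (hs : HasCircumradiusLE d s Q) {u v : EuclideanSpace ℝ (Fin d)} (hu : u ∈ s) (hv : v ∈ s) :
    dist u v ≤ 2 * Q := by
  obtain ⟨c, ρ, hρ, h⟩ := hs
  linarith [dist_triangle_right u v c, h u hu, h v hv]

lemma HasCircumradiusLE.mono {s : Finset (EuclideanSpace ℝ (Fin d))} {Q Q' : ℝ}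
    (hs : HasCircumradiusLE d s Q) (hQ : Q ≤ Q') : HasCircumradiusLE d s Q' := by
  obtain ⟨c, ρ, hρ, h⟩ := hs
  exact ⟨c, ρ, hρ.trans hQ, h⟩

end Spheres

section Triangulations

variable {d : ℕ} {X : Set (EuclideanSpace ℝ (Fin d))} {r q : ℝ}
  {T : Geometry.SimplicialComplex ℝ (EuclideanSpace ℝ (Fin d))}

lemma IsTriangulationOf.coe_subset (hT : IsTriangulationOf d T X)
    {s : Finset (EuclideanSpace ℝ (Fin d))} (hs : s ∈ T.faces) :
    (s : Set (EuclideanSpace ℝ (Fin d))) ⊆ X := by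
  rw [← hT.1, Geometry.SimplicialComplex.vertices_eq]
  exact Set.subset_biUnion_of_mem (u := fun k : Finset (EuclideanSpace ℝ (Fin d)) =>
    (k : Set (EuclideanSpace ℝ (Fin d)))) hs

lemma UniformlyBounded.dist_le (hTq : UniformlyBounded d T q)
    {s : Finset (EuclideanSpace ℝ (Fin d))} (hs : s ∈ T.faces) (hsc : s.card = d + 1)
    {v x : EuclideanSpace ℝ (Fin d)} (hv : v ∈ s)
    (hx : x ∈ convexHull ℝ (s : Set (EuclideanSpace ℝ (Fin d)))) : dist x v ≤ 2 * q :=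
  convexHull_min (t := closedBall v (2 * q)) (fun _ hu => (hTq s hs hsc).dist_le hu hv)
    (convex_closedBall _ _) hx

/-- The full-dimensional simplices of a uniformly bounded triangulation cover the space. -/
lemma UniformlyBounded.exists_mem_convexHull (hr : 0 < r)
    (hX : X.Pairwise fun u v => 2 * r ≤ dist u v) (hT : IsTriangulationOf d T X) (hq : 0 ≤ q)
    (hTq : UniformlyBounded d T q) (p : EuclideanSpace ℝ (Fin d)) :
    ∃ s ∈ T.faces, s.card = d + 1 ∧ p ∈ convexHull ℝ (s : Set (EuclideanSpace ℝ (Fin d))) := by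
  by_contra! hp
  let S : Set (Finset (EuclideanSpace ℝ (Fin d))) :=
    {s | s ∈ T.faces ∧ s.card = d + 1 ∧
      ∃ v ∈ s, v ∈ (finite_inter_closedBall hr hX p (1 + 2 * q)).toFinset}
  have hS : S.Finite := (finite_and_ncard_le hr hX (Q := 2 * q) (by linarith) _
    (fun s hs => hT.coe_subset hs.1) (fun s hs u hu v hv => (hTq s hs.1 hs.2.1).dist_le hu hv)
    (fun s hs => hs.2.2)).1
  have hclosed : IsClosed (⋃ s ∈ S, convexHull ℝ (s : Set (EuclideanSpace ℝ (Fin d)))) :=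
    hS.isClosed_biUnion fun s _ => (s.finite_toSet.isCompact_convexHull ℝ).isClosed
  have hopen := isOpen_ball (x := p) (ε := 1) |>.sdiff hclosed
  have hpos := hopen.measure_pos volume ⟨p, mem_ball_self one_pos, by
    simp only [Set.mem_iUnion, not_exists]
    exact fun s hs => hp s hs.1 hs.2.1⟩
  have hcount : X.Countable := by
    refine (Set.countable_iUnion fun n : ℕ =>
      (finite_inter_closedBall hr hX 0 n).countable).mono fun x hx => ?_
    obtain ⟨n, hn⟩ := exists_nat_ge (dist x 0)
    exact Set.mem_iUnion.2 ⟨n, hx, hn⟩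
  have hfaces : {s | s ∈ T.faces ∧ s.card ≠ d + 1}.Countable := by
    have h := (Set.countable_ofPred_finite_subset hcount).preimage_of_injOn
      (Finset.coe_injective (α := EuclideanSpace ℝ (Fin d))).injOn
    refine h.mono fun s hs => Set.mem_preimage.2 ?_
    exact ⟨s.finite_toSet, hT.coe_subset hs.1⟩
  have hnull : volume (⋃ s ∈ {s | s ∈ T.faces ∧ s.card ≠ d + 1},
      convexHull ℝ (s : Set (EuclideanSpace ℝ (Fin d)))) = 0 :=
    (measure_biUnion_null_iff hfaces).2 fun s hs =>
      measure_mono_null (convexHull_subset_affineSpan _)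
        (Measure.addHaar_affineSubspace volume _ ((T.indep hs.1).affineSpan_finset_ne_top hs.2))
  refine hpos.ne' (measure_mono_null (fun x hx => ?_) hnull)
  obtain ⟨s, hs, hxs⟩ := Geometry.SimplicialComplex.mem_space_iff.1
    (hT.2 ▸ Set.mem_univ x : x ∈ T.space)
  refine Set.mem_biUnion (x := s) ⟨hs, fun hsc => hx.2 ?_⟩ hxs
  obtain ⟨v, hv⟩ := T.nonempty_of_mem_faces hs
  refine Set.mem_biUnion (x := s) ⟨hs, hsc, v, hv, ?_⟩ hxs
  have h1 := hTq.dist_le hs hsc hv hxs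
  have h2 := mem_ball.1 hx.1
  rw [Set.Finite.mem_toFinset]
  refine ⟨hT.coe_subset hs hv, mem_closedBall.2 ?_⟩
  linarith [dist_triangle_left v p x]

/-- The full-dimensional simplices of `T` contained in the closed ball of radius `α` about the
origin. -/
def cellsInBall (d : ℕ) (T : Geometry.SimplicialComplex ℝ (EuclideanSpace ℝ (Fin d))) (α : ℝ) :
    Set (Finset (EuclideanSpace ℝ (Fin d))) :=
  {s | s ∈ T.faces ∧ s.card = d + 1 ∧ (s : Set (EuclideanSpace ℝ (Fin d))) ⊆ closedBall 0 α}

/-- The subcomplex of `T` generated by its full-dimensional simplices contained in the closed ball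
of radius `α` about the origin. -/
def ballSubcomplex (d : ℕ) (T : Geometry.SimplicialComplex ℝ (EuclideanSpace ℝ (Fin d))) (α : ℝ) :
    Geometry.SimplicialComplex ℝ (EuclideanSpace ℝ (Fin d)) where
  faces := {t | t.Nonempty ∧ ∃ s ∈ cellsInBall d T α, t ⊆ s}
  isRelLowerSet_faces := fun _ ht => ⟨ht.1, fun _ hb hb0 =>
    ⟨hb0, ht.2.imp fun _ hs => ⟨hs.1, hb.trans hs.2⟩⟩⟩
  indep := fun ⟨h0, _, hs, hts⟩ => T.indep (T.down_closed hs.1 hts h0)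
  inter_subset_convexHull := fun ⟨h0, _, hs, hts⟩ ⟨h0', _, hs', hts'⟩ =>
    T.inter_subset_convexHull (T.down_closed hs.1 hts h0) (T.down_closed hs'.1 hts' h0')

lemma mem_faces_of_mem_ballSubcomplex {α : ℝ} {t : Finset (EuclideanSpace ℝ (Fin d))}
    (ht : t ∈ (ballSubcomplex d T α).faces) : t ∈ T.faces := by
  obtain ⟨h0, s, hs, hts⟩ := ht
  exact T.down_closed hs.1 hts h0

lemma mem_ballSubcomplex_of_mem_cellsInBall {α : ℝ} {s : Finset (EuclideanSpace ℝ (Fin d))}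
    (hs : s ∈ cellsInBall d T α) : s ∈ (ballSubcomplex d T α).faces :=
  ⟨T.nonempty_of_mem_faces hs.1, s, hs, subset_rfl⟩

lemma cells_ballSubcomplex (α : ℝ) :
    {s | s ∈ (ballSubcomplex d T α).faces ∧ s.card = d + 1} = cellsInBall d T α := by
  ext s
  refine ⟨fun ⟨⟨_, t, ht, hst⟩, hsc⟩ => ?_,
    fun hs => ⟨mem_ballSubcomplex_of_mem_cellsInBall hs, hs.2.1⟩⟩
  rwa [Finset.eq_of_subset_of_card_le hst (by rw [ht.2.1, hsc])]

lemma space_ballSubcomplex_subset (α : ℝ) : (ballSubcomplex d T α).space ⊆ closedBall 0 α := by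
  intro x hx
  obtain ⟨t, ⟨_, s, hs, hts⟩, hxt⟩ := Geometry.SimplicialComplex.mem_space_iff.1 hx
  exact convexHull_min ((Finset.coe_subset.2 hts).trans hs.2.2) (convex_closedBall _ _) hxt

lemma cellsInBall_finite_and_ncard_le (hr : 0 < r)
    (hX : X.Pairwise fun u v => 2 * r ≤ dist u v) (hT : IsTriangulationOf d T X) (hq : 0 ≤ q)
    (hTq : UniformlyBounded d T q) {α : ℝ} (hα : 0 ≤ α) :
    (cellsInBall d T α).Finite ∧ (cellsInBall d T α).ncard * r ^ d ≤
      2 ^ ⌊(2 * q + r) ^ d / r ^ d⌋₊ * (α + r) ^ d := by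
  obtain ⟨hfin, hcard⟩ := finite_and_ncard_le hr hX (Q := 2 * q) (S := cellsInBall d T α)
    (by linarith) (finite_inter_closedBall hr hX 0 α).toFinset (fun s hs => hT.coe_subset hs.1)
    (fun s hs u hu v hv => (hTq s hs.1 hs.2.1).dist_le hu hv) (fun s hs => by
      obtain ⟨v, hv⟩ := T.nonempty_of_mem_faces hs.1
      exact ⟨v, hv, (Set.Finite.mem_toFinset _).2 ⟨hT.coe_subset hs.1 hv, hs.2.2 hv⟩⟩)
  refine ⟨hfin, ?_⟩
  have hV := card_mul_pow_le hr (A := (finite_inter_closedBall hr hX 0 α).toFinset)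
    (hX.mono (by simp)) (z := 0) hα (by simp)
  have hcard' : ((cellsInBall d T α).ncard : ℝ) ≤
      (finite_inter_closedBall hr hX 0 α).toFinset.card * 2 ^ ⌊(2 * q + r) ^ d / r ^ d⌋₊ := by
    exact_mod_cast hcard
  calc ((cellsInBall d T α).ncard : ℝ) * r ^ d
      ≤ (finite_inter_closedBall hr hX 0 α).toFinset.card *
          2 ^ ⌊(2 * q + r) ^ d / r ^ d⌋₊ * r ^ d := by gcongr
    _ = 2 ^ ⌊(2 * q + r) ^ d / r ^ d⌋₊ *
          ((finite_inter_closedBall hr hX 0 α).toFinset.card * r ^ d) := by ring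
    _ ≤ _ := by gcongr

/-- The full-dimensional simplices in the ball of radius `α` that have a vertex at distance more
than `a` from the origin. -/
lemma ncard_cellsInBall_annulus_le (hr : 0 < r)
    (hX : X.Pairwise fun u v => 2 * r ≤ dist u v) (hT : IsTriangulationOf d T X) (hq : 0 ≤ q)
    (hTq : UniformlyBounded d T q) {α a : ℝ} (ha : r ≤ a) (haα : a ≤ α) :
    {s ∈ cellsInBall d T α | ∃ v ∈ s, a < dist v 0}.ncard * r ^ d ≤
      2 ^ ⌊(2 * q + r) ^ d / r ^ d⌋₊ * ((α + r) ^ d - (a - r) ^ d) := by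
  classical
  set V := (finite_inter_closedBall hr hX 0 α).toFinset.filter fun v => a < dist v 0 with hVdef
  have hmem : ∀ v, v ∈ V ↔ (v ∈ X ∧ dist v 0 ≤ α) ∧ a < dist v 0 := fun v => by
    simp [hVdef]
  obtain ⟨-, hcard⟩ := finite_and_ncard_le hr hX (Q := 2 * q)
    (S := {s ∈ cellsInBall d T α | ∃ v ∈ s, a < dist v 0})
    (by linarith) V (fun s hs => hT.coe_subset hs.1.1)
    (fun s hs u hu v hv => (hTq s hs.1.1 hs.1.2.1).dist_le hu hv) (fun s hs => by
      obtain ⟨hs, v, hv, hav⟩ := hs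
      exact ⟨v, hv, (hmem v).2 ⟨⟨hT.coe_subset hs.1 hv, hs.2.2 hv⟩, hav⟩⟩)
  have hV := card_mul_pow_le_of_annulus hr (A := V) (z := 0)
    (hX.mono fun v hv => ((hmem v).1 hv).1.1) ha haα
    fun v hv => ⟨((hmem v).1 hv).2, ((hmem v).1 hv).1.2⟩
  have hcard' : ({s ∈ cellsInBall d T α | ∃ v ∈ s, a < dist v 0}.ncard : ℝ) ≤
      V.card * 2 ^ ⌊(2 * q + r) ^ d / r ^ d⌋₊ := by
    exact_mod_cast hcard
  calc ({s ∈ cellsInBall d T α | ∃ v ∈ s, a < dist v 0}.ncard : ℝ) * r ^ d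
      ≤ V.card * 2 ^ ⌊(2 * q + r) ^ d / r ^ d⌋₊ * r ^ d := by gcongr
    _ = 2 ^ ⌊(2 * q + r) ^ d / r ^ d⌋₊ * (V.card * r ^ d) := by ring
    _ ≤ _ := by gcongr

lemma finsum_mem_le_ncard_mul {ι : Type*} {S : Set ι} (hS : S.Finite) {f : ι → ℝ} {C : ℝ}
    (hf : ∀ i ∈ S, f i ≤ C) : ∑ᶠ i ∈ S, f i ≤ S.ncard * C := by
  rw [finsum_mem_eq_finite_toFinset_sum _ hS, Set.ncard_eq_toFinset_card _ hS, ← nsmul_eq_mul]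
  exact Finset.sum_le_card_nsmul _ _ _ fun i hi => hf i (by simpa using hi)

lemma abs_finsum_mem_le_ncard_mul {ι : Type*} {S : Set ι} (hS : S.Finite) {f : ι → ℝ} {C : ℝ}
    (hf : ∀ i ∈ S, |f i| ≤ C) : |∑ᶠ i ∈ S, f i| ≤ S.ncard * C := by
  have h := finsum_mem_le_ncard_mul hS hf
  rw [finsum_mem_eq_finite_toFinset_sum _ hS] at h ⊢
  exact (Finset.abs_sum_le_sum_abs _ _).trans h

/-- Within a ball, the functional on the Delaunay triangulation exceeds its value on `T` by at most
the contribution of the Delaunay simplices near the boundary sphere. -/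
lemma finsum_cellsInBall_le {R C : ℝ} (hr : 0 < r) (hR : 0 ≤ R) (hX : DelaunaySet d X r R)
    (hgen : Generic d X) {D : Geometry.SimplicialComplex ℝ (EuclideanSpace ℝ (Fin d))}
    (hD : IsDelaunayTriangulation d D X) (hT : IsTriangulationOf d T X) (hq : 0 ≤ q)
    (hTq : UniformlyBounded d T q) {F : Finset (EuclideanSpace ℝ (Fin d)) → ℝ}
    (hG : InClassG d F) {α : ℝ} (hα : 0 ≤ α) (hC : 0 ≤ C) (hF : ∀ s ∈ cellsInBall d D α, F s ≤ C) :
    ∑ᶠ s ∈ cellsInBall d D α, F s ≤ ∑ᶠ s ∈ cellsInBall d T α, F s +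
      {s ∈ cellsInBall d D α | ∃ v ∈ s, α - 2 * q < dist v 0}.ncard * C := by
  classical
  have hsep := hX.two_mul_le_dist
  have hDR : UniformlyBounded d D R := fun s hs hsc => (hD.2 s hs hsc).hasCircumradiusLE hX
  have hDfin := (cellsInBall_finite_and_ncard_le hr hsep hD.1 hR hDR hα).1
  have hwit : ∀ s : Finset (EuclideanSpace ℝ (Fin d)), ∃ Y : Finset (EuclideanSpace ℝ (Fin d)),
      (Y : Set (EuclideanSpace ℝ (Fin d))) ⊆ X ∧
      (AffineIndependent ℝ ((↑) : s → EuclideanSpace ℝ (Fin d)) → s.card = d + 1 →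
        ∀ Z : Set (EuclideanSpace ℝ (Fin d)), ↑Y ⊆ Z →
          EmptySimplex d s Z → EmptySimplex d s X) := fun s => by
    by_cases hs : AffineIndependent ℝ ((↑) : s → EuclideanSpace ℝ (Fin d)) ∧ s.card = d + 1
    · obtain ⟨Y, hY, h⟩ := exists_finset_emptySimplex (X := X) s hs.1 hs.2
      exact ⟨Y, hY, fun _ _ => h⟩
    · exact ⟨∅, by simp, fun h h' => (hs ⟨h, h'⟩).elim⟩
  choose W hWX hW using hwit
  set A := (finite_inter_closedBall hr hsep 0 α).toFinset with hAdef
  have hA : ∀ v, v ∈ A ↔ v ∈ X ∧ v ∈ closedBall 0 α := fun v => by simp [hAdef]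
  set Y := A ∪ A.powerset.biUnion W with hYdef
  have hYX : (Y : Set (EuclideanSpace ℝ (Fin d))) ⊆ X := by
    intro v hv
    rcases Finset.mem_union.1 hv with hv | hv
    · exact ((hA v).1 hv).1
    · obtain ⟨s, -, hv⟩ := Finset.mem_biUnion.1 hv
      exact hWX s hv
  have hfaces : ∀ t ∈ (ballSubcomplex d T α).faces, ∀ v ∈ t, v ∈ A := fun t ht v hv => by
    obtain ⟨_, s, hs, hts⟩ := ht
    exact (hA v).2 ⟨hT.coe_subset hs.1 (hts hv), hs.2.2 (hts hv)⟩
  have key := hG Y (fun Z hZ => hgen Z (hZ.trans hYX)) (ballSubcomplex d T α)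
    (fun v hv => Finset.mem_union_left _ (hfaces {v} hv v (by simp))) fun y hy hys => by
      obtain ⟨t, ht, hyt⟩ := Geometry.SimplicialComplex.mem_space_iff.1 hys
      have hyT : y ∈ T.vertices := hT.1 ▸ hYX hy
      rw [Geometry.SimplicialComplex.vertex_mem_convexHull_iff hyT
        (mem_faces_of_mem_ballSubcomplex ht)] at hyt
      exact (ballSubcomplex d T α).down_closed ht (Finset.singleton_subset_iff.2 hyt)
        (Finset.singleton_nonempty y)
  rw [cells_ballSubcomplex] at key
  set P := {s : Finset (EuclideanSpace ℝ (Fin d)) |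
    ↑s ⊆ (Y : Set (EuclideanSpace ℝ (Fin d))) ∧ s.card = d + 1 ∧
    AffineIndependent ℝ ((↑) : ↑s → EuclideanSpace ℝ (Fin d)) ∧
    EmptySimplex d s ↑Y ∧
    convexHull ℝ (s : Set (EuclideanSpace ℝ (Fin d))) ⊆ (ballSubcomplex d T α).space} with hP
  have hPD : P ⊆ cellsInBall d D α := by
    rintro s ⟨hsY, hsc, hsi, hse, hss⟩
    have hsα := ((subset_convexHull ℝ _).trans hss).trans (space_ballSubcomplex_subset α)
    have hsX := hsY.trans hYX
    have hsA : s ∈ A.powerset := Finset.mem_powerset.2 fun v hv => (hA v).2 ⟨hsX hv, hsα hv⟩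
    have hse' := hW s hsi hsc Y (fun v hv =>
      Finset.mem_union_right _ (Finset.mem_biUnion.2 ⟨s, hsA, hv⟩)) hse
    obtain ⟨t, ht, htc, hst⟩ := hDR.exists_mem_convexHull hr hsep hD.1 hR
      (s.centerMass (fun _ => (1 : ℝ)) id)
    obtain rfl := hse'.eq_of_centroid_mem hgen hsX (hD.1.coe_subset ht) hsc htc (hD.2 t ht htc) hst
    exact ⟨ht, hsc, hsα⟩
  have hdiff : cellsInBall d D α \ P ⊆
      {s ∈ cellsInBall d D α | ∃ v ∈ s, α - 2 * q < dist v 0} := by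
    rintro s ⟨hs, hsP⟩
    refine ⟨hs, ?_⟩
    by_contra! hv
    refine hsP ⟨fun v hv => Finset.mem_union_left _
      ((hA v).2 ⟨hD.1.coe_subset hs.1 hv, hs.2.2 hv⟩), hs.2.1, D.indep hs.1,
      (hD.2 s hs.1 hs.2.1).mono hYX, fun x hx => ?_⟩
    have hx0 : x ∈ closedBall (0 : EuclideanSpace ℝ (Fin d)) (α - 2 * q) :=
      convexHull_min (fun v hvs => hv v hvs) (convex_closedBall _ _) hx
    obtain ⟨t, ht, htc, hxt⟩ := hTq.exists_mem_convexHull hr hsep hT hq x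
    refine Geometry.SimplicialComplex.convexHull_subset_space
      (mem_ballSubcomplex_of_mem_cellsInBall ⟨ht, htc, fun v hvt => ?_⟩) hxt
    have h1 := hTq.dist_le ht htc hvt hxt
    have h2 := mem_closedBall.1 hx0
    rw [mem_closedBall]
    linarith [dist_triangle_left v 0 x]
  have hcard : ((cellsInBall d D α \ P).ncard : ℝ) ≤
      {s ∈ cellsInBall d D α | ∃ v ∈ s, α - 2 * q < dist v 0}.ncard := by
    exact_mod_cast Set.ncard_le_ncard hdiff (hDfin.subset fun s hs => hs.1)
  have hrest := finsum_mem_le_ncard_mul (hDfin.subset Set.sdiff_subset) (S := cellsInBall d D α \ P)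
    fun s hs => hF s hs.1
  rw [← finsum_mem_add_sdiff hPD hDfin]
  have := mul_le_mul_of_nonneg_right hcard hC
  linarith

end Triangulations

section Density

lemma liminf_le_liminf_of_le_add {u v δ : ℝ → ℝ} {M : ℝ} (hu : ∀ᶠ α in atTop, |u α| ≤ M)
    (hv : ∀ᶠ α in atTop, |v α| ≤ M) (hδ : Tendsto δ atTop (nhds 0))
    (huv : ∀ᶠ α in atTop, u α ≤ v α + δ α) : liminf u atTop ≤ liminf v atTop := by
  have hub : IsBoundedUnder (· ≥ ·) atTop u :=
    isBoundedUnder_of_eventually_ge (a := -M) (hu.mono fun α h => (abs_le.1 h).1)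
  have hvb : IsCoboundedUnder (· ≥ ·) atTop v :=
    (isBoundedUnder_of_eventually_le (a := M)
      (hv.mono fun α h => (abs_le.1 h).2)).isCoboundedUnder_ge
  refine le_of_forall_pos_le_add fun ε hε => ?_
  have h1 : ∀ᶠ α in atTop, liminf u atTop - ε / 2 < u α :=
    eventually_lt_of_lt_liminf (by linarith) hub
  have h2 : ∀ᶠ α in atTop, δ α < ε / 2 := hδ.eventually_lt_const (by linarith)
  have h3 : liminf u atTop - ε ≤ liminf v atTop := by
    refine le_liminf_of_le hvb ?_
    filter_upwards [h1, h2, huv] with α h1 h2 h3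
    linarith
  linarith

lemma tendsto_annulus_div_pow (d : ℕ) (a b : ℝ) :
    Tendsto (fun α : ℝ => ((α + a) ^ d - (α - b) ^ d) / α ^ d) atTop (nhds 0) := by
  have h : Tendsto (fun α : ℝ => (1 + a / α) ^ d - (1 - b / α) ^ d) atTop
      (nhds ((1 + 0) ^ d - (1 - 0) ^ d)) :=
    ((tendsto_const_nhds.add (tendsto_const_nhds.div_atTop tendsto_id)).pow d).sub
      ((tendsto_const_nhds.sub (tendsto_const_nhds.div_atTop tendsto_id)).pow d)
  simp only [add_zero, sub_zero, sub_self] at h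
  refine h.congr' ?_
  filter_upwards [eventually_gt_atTop 0] with α hα
  rw [sub_div, ← div_pow, ← div_pow, add_div, sub_div, div_self hα.ne']

/-- The quotients defining the density are eventually bounded. -/
lemma exists_eventually_abs_density_quotient_le {d : ℕ} {X : Set (EuclideanSpace ℝ (Fin d))}
    {r q C : ℝ} {T : Geometry.SimplicialComplex ℝ (EuclideanSpace ℝ (Fin d))} (hr : 0 < r)
    (hX : X.Pairwise fun u v => 2 * r ≤ dist u v) (hT : IsTriangulationOf d T X) (hq : 0 ≤ q)
    (hTq : UniformlyBounded d T q) {F : Finset (EuclideanSpace ℝ (Fin d)) → ℝ} (hC : 0 ≤ C)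
    (hF : ∀ s ∈ T.faces, s.card = d + 1 → |F s| ≤ C) :
    ∃ M, ∀ᶠ α in atTop, |(∑ᶠ s ∈ cellsInBall d T α, F s) /
      volume.real (closedBall (0 : EuclideanSpace ℝ (Fin d)) α)| ≤ M := by
  set ω := volume.real (ball (0 : EuclideanSpace ℝ (Fin d)) 1)
  have hω : 0 < ω := volume_real_unitBall_pos
  set K : ℝ := 2 ^ ⌊(2 * q + r) ^ d / r ^ d⌋₊
  refine ⟨K * 2 ^ d / r ^ d * C / ω, ?_⟩
  filter_upwards [eventually_ge_atTop r] with α hα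
  have hα0 : 0 < α := hr.trans_le hα
  obtain ⟨hfin, hcard⟩ := cellsInBall_finite_and_ncard_le hr hX hT hq hTq hα0.le
  have h := abs_finsum_mem_le_ncard_mul hfin fun s hs => hF s hs.1 hs.2.1
  rw [volume_real_closedBall _ hα0.le, abs_div, abs_of_pos (by positivity : 0 < α ^ d * ω),
    div_le_div_iff₀ (by positivity) hω]
  have hpow : (α + r) ^ d ≤ 2 ^ d * α ^ d := by
    rw [← mul_pow]
    gcongr
    linarith
  have hn : ((cellsInBall d T α).ncard : ℝ) ≤ K * 2 ^ d / r ^ d * α ^ d := by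
    rw [div_mul_eq_mul_div, le_div_iff₀ (by positivity)]
    calc _ ≤ K * (α + r) ^ d := hcard
      _ ≤ K * (2 ^ d * α ^ d) := by gcongr
      _ = _ := by ring
  calc _ ≤ (cellsInBall d T α).ncard * C * ω := by gcongr
    _ ≤ K * 2 ^ d / r ^ d * α ^ d * C * ω := by gcongr
    _ = _ := by ring

end Density

/-- Main Theorem, `d`-dimensional case: if `F` belongs to class `G`, then the Delaunay
triangulation minimizes the density of `F` among all uniformly bounded triangulations of a
generic Delaunay set in `ℝ^d`. -/
theorem main_theorem_d_dimensional (d : ℕ) (X : Set (EuclideanSpace ℝ (Fin d))) (r R : ℝ)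
    (hr : 0 < r) (hrR : r < R) (hX : DelaunaySet d X r R) (hgen : Generic d X)
    (D : Geometry.SimplicialComplex ℝ (EuclideanSpace ℝ (Fin d)))
    (hD : IsDelaunayTriangulation d D X)
    (T : Geometry.SimplicialComplex ℝ (EuclideanSpace ℝ (Fin d)))
    (hT : IsTriangulationOf d T X) (q : ℝ) (hq : 0 < q) (hTq : UniformlyBounded d T q)
    (F : Finset (EuclideanSpace ℝ (Fin d)) → ℝ) (e E : ℝ)
    (hF : ∀ s : Finset (EuclideanSpace ℝ (Fin d)), s.card = d + 1 →
      (∀ u ∈ s, ∀ v ∈ s, u ≠ v → 2 * r ≤ dist u v) →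
      HasCircumradiusLE d s (max q R) → e ≤ F s ∧ F s ≤ E)
    (hG : InClassG d F) :
    density d F D ≤ density d F T := by
  have hR : 0 ≤ R := (hr.trans hrR).le
  have hsep := hX.two_mul_le_dist
  have hDR : UniformlyBounded d D R := fun s hs hsc => (hD.2 s hs hsc).hasCircumradiusLE hX
  set C := max |e| |E|
  have hC : 0 ≤ C := (abs_nonneg e).trans (le_max_left _ _)
  have hFC : ∀ K : Geometry.SimplicialComplex ℝ (EuclideanSpace ℝ (Fin d)),
      IsTriangulationOf d K X → ∀ Q ≤ max q R, UniformlyBounded d K Q →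
        ∀ s ∈ K.faces, s.card = d + 1 → |F s| ≤ C := fun K hK Q hQ hKQ s hs hsc => by
    obtain ⟨h1, h2⟩ := hF s hsc
      (fun u hu v hv huv => hsep (hK.coe_subset hs hu) (hK.coe_subset hs hv) huv)
      ((hKQ s hs hsc).mono hQ)
    exact abs_le_max_abs_abs h1 h2
  have hFD := hFC D hD.1 R (le_max_right _ _) hDR
  have hFT := hFC T hT q (le_max_left _ _) hTq
  obtain ⟨M, hM⟩ := exists_eventually_abs_density_quotient_le hr hsep hD.1 hR hDR hC hFD
  obtain ⟨M', hM'⟩ := exists_eventually_abs_density_quotient_le hr hsep hT hq.le hTq hC hFT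
  set ω := volume.real (ball (0 : EuclideanSpace ℝ (Fin d)) 1)
  have hω : 0 < ω := volume_real_unitBall_pos
  set K : ℝ := 2 ^ ⌊(2 * R + r) ^ d / r ^ d⌋₊
  refine liminf_le_liminf_of_le_add (M := max M M')
    (δ := fun α => K * C / (r ^ d * ω) * (((α + r) ^ d - (α - (2 * q + r)) ^ d) / α ^ d))
    (hM.mono fun α h => h.trans (le_max_left _ _)) (hM'.mono fun α h => h.trans (le_max_right _ _))
    (by simpa using (tendsto_annulus_div_pow d r (2 * q + r)).const_mul (K * C / (r ^ d * ω))) ?_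
  filter_upwards [eventually_ge_atTop (2 * q + r)] with α hα
  have hα0 : 0 < α := by linarith
  have hsum := finsum_cellsInBall_le hr hR hX hgen hD hT hq.le hTq hG hα0.le hC
    fun s hs => (le_abs_self _).trans (hFD s hs.1 hs.2.1)
  have hcard := ncard_cellsInBall_annulus_le hr hsep hD.1 hR hDR (α := α)
    (by linarith : r ≤ α - 2 * q)
    (by linarith)
  rw [← le_div_iff₀ (by positivity), sub_sub] at hcard
  change (∑ᶠ s ∈ cellsInBall d D α, F s) / volume.real (closedBall 0 α) ≤
    (∑ᶠ s ∈ cellsInBall d T α, F s) / volume.real (closedBall 0 α) + _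
  rw [volume_real_closedBall _ hα0.le]
  calc _ ≤ (∑ᶠ s ∈ cellsInBall d T α, F s + K * ((α + r) ^ d - (α - (2 * q + r)) ^ d) / r ^ d * C)
        / (α ^ d * ω) := by
        gcongr
        exact hsum.trans (by gcongr)
    _ = _ := by
        rw [add_div]
        congr 1
        field_simp
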